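/- Given conditions (D1) and (D2), Φ₁ = Φ₁⁺ ⊎ Φ₁⁻ (a disjoint union) holds if and only if for all s, t ∈ S the following three conditions are satisfied: (D3) ⟨α_s, β_t⟩ ≤ 0 and ⟨α_t, β_s⟩ ≤ 0 whenever s ≠ t; (D4) ⟨α_s, β_t⟩ = 0 if and only if ⟨α_t, β_s⟩ = 0; (D5) either ⟨α_s, β_t⟩⟨α_t, β_s⟩ = cos²(π/m_{st}) for some integer m_{st} ≥ 2, or else ⟨α_s, β_t⟩⟨α_t, β_s⟩ ≥ 1. -/

import Mathlib

open Pointwise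

/-- The positive linear cone of a subset `A` of a real vector space: the set of
finite linear combinations of elements of `A` with all coefficients nonnegative
and at least one coefficient strictly positive. -/
def PLC {V : Type*} [AddCommGroup V] [Module ℝ V] (A : Set V) : Set V :=
  { v | ∃ c : V →₀ ℝ, (∀ a, 0 ≤ c a) ∧ ↑c.support ⊆ A ∧ c ≠ 0 ∧
          v = c.sum fun a t => t • a }


section helpers

variable {V : Type*} [AddCommGroup V] [Module ℝ V]

theorem PLC_add {A : Set V} {u v : V} (hu : u ∈ PLC A) (hv : v ∈ PLC A) : u + v ∈ PLC A := by
  classical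
  obtain ⟨c, h1, h2, h3, rfl⟩ := hu
  obtain ⟨d, g1, g2, g3, rfl⟩ := hv
  refine ⟨c + d, fun a => add_nonneg (h1 a) (g1 a), ?_, ?_, ?_⟩
  · intro a ha
    rcases Finset.mem_union.1 (Finsupp.support_add ha) with h | h
    · exact h2 h
    · exact g2 h
  · intro h
    apply h3
    ext a
    have := DFunLike.congr_fun h a
    simp only [Finsupp.add_apply, Finsupp.zero_apply] at this ⊢
    linarith [h1 a, g1 a]
  · rw [Finsupp.sum_add_index']
    · simp
    · intros; rw [add_smul]

theorem PLC_smul {A : Set V} {u : V} {x : ℝ} (hx : 0 < x) (hu : u ∈ PLC A) : x • u ∈ PLC A := by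
  obtain ⟨c, h1, h2, h3, rfl⟩ := hu
  refine ⟨x • c, fun a => mul_nonneg hx.le (h1 a), ?_, ?_, ?_⟩
  · intro a ha
    exact h2 (Finsupp.support_smul ha)
  · exact smul_ne_zero hx.ne' h3
  · rw [Finsupp.sum_smul_index' (by simp), Finsupp.smul_sum]
    simp [mul_smul]

theorem PLC_mem {A : Set V} {a : V} (ha : a ∈ A) : a ∈ PLC A := by
  classical
  refine ⟨Finsupp.single a 1, ?_, ?_, ?_, ?_⟩
  · intro b
    rw [Finsupp.single_apply]
    split_ifs <;> norm_num
  · intro b hb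
    have := Finsupp.support_single_subset hb
    simp at this
    exact this ▸ ha
  · simp
  · simp

theorem PLC_mono {A B : Set V} (h : A ⊆ B) {u : V} (hu : u ∈ PLC A) : u ∈ PLC B := by
  obtain ⟨c, h1, h2, h3, rfl⟩ := hu
  exact ⟨c, h1, h2.trans h, h3, rfl⟩

theorem PLC_split {A : Set V} {u : V} (a : V) (hu : u ∈ PLC A) :
    ∃ x : ℝ, ∃ r : V, u = x • a + r ∧ (r = 0 ∨ r ∈ PLC (A \ {a})) := by
  classical
  obtain ⟨c, h1, h2, h3, rfl⟩ := hu
  refine ⟨c a, (c.erase a).sum fun a t => t • a, ?_, ?_⟩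
  · rw [Finsupp.add_sum_erase' c a (fun a t => t • a) (by simp)]
  · by_cases h : c.erase a = 0
    · left; simp [h]
    · right
      refine ⟨c.erase a, ?_, ?_, h, rfl⟩
      · intro b
        rw [Finsupp.erase_apply]
        split_ifs
        · exact le_rfl
        · exact h1 b
      · intro b hb
        simp only [Finsupp.support_erase, Finset.coe_erase] at hb
        exact ⟨h2 hb.1, hb.2⟩

theorem PLC_comb {A : Set V} {u v : V} {p q : ℝ} (hu : u ∈ PLC A) (hv : v ∈ PLC A)
    (hp : 0 ≤ p) (hq : 0 ≤ q) (h : 0 < p ∨ 0 < q) : p • u + q • v ∈ PLC A := by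
  rcases hp.eq_or_lt with rfl | hp
  · have : 0 < q := by simpa using h
    simpa using PLC_smul this hv
  · rcases hq.eq_or_lt with rfl | hq
    · simpa using PLC_smul hp hu
    · exact PLC_add (PLC_smul hp hu) (PLC_smul hq hv)

theorem PLC_mixed {A : Set V} {a b : V} (ha : a ∈ A) (hb : b ∈ A) (hab : b ≠ a)
    (h0 : (0 : V) ∉ PLC A) (h1 : a ∉ PLC (A \ {a})) {p q : ℝ} (hq : 0 < q) :
    p • a - q • b ∉ PLC A := by
  intro h
  obtain ⟨x, r, hx, hr⟩ := PLC_split a h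
  have hb' : q • b ∈ PLC (A \ {a}) := PLC_smul hq (PLC_mem ⟨hb, hab⟩)
  have hqr : q • b + r ∈ PLC (A \ {a}) := by
    rcases hr with rfl | hr
    · simpa using hb'
    · exact PLC_add hb' hr
  have e : (p - x) • a = q • b + r := by
    rw [sub_eq_iff_eq_add] at hx
    rw [sub_smul, hx]
    abel
  rcases lt_or_ge x p with hlt | hle
  · apply h1
    have := PLC_smul (inv_pos.2 (sub_pos.2 hlt)) hqr
    rwa [← e, smul_smul, inv_mul_cancel₀ (sub_pos.2 hlt).ne', one_smul] at this
  · apply h0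
    have := PLC_comb (p := x - p) (q := 1) (PLC_mem ha) (PLC_mono Set.sdiff_subset hqr)
      (sub_nonneg.2 hle) zero_le_one (Or.inr one_pos)
    rwa [one_smul, ← e, ← add_smul, sub_add_sub_cancel, sub_self, zero_smul] at this

/-- Chebyshev numbers. -/
noncomputable def chebU (c : ℝ) : ℕ → ℝ
  | 0 => 0
  | 1 => 1
  | n + 2 => 2 * c * chebU c (n + 1) - chebU c n

theorem chebU_cos (θ : ℝ) (n : ℕ) : chebU (Real.cos θ) n * Real.sin θ = Real.sin (n * θ) := by
  induction n using Nat.twoStepInduction with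
  | zero => simp [chebU]
  | one => simp [chebU]
  | more n h1 h2 =>
    rw [chebU, sub_mul, mul_assoc, h1, h2]
    push_cast
    have e1 : ((n : ℝ) + 2) * θ = (n + 1) * θ + θ := by ring
    have e2 : (n : ℝ) * θ = (n + 1) * θ - θ := by ring
    rw [e1, e2, Real.sin_add, Real.sin_sub]
    ring

theorem chebU_ge {c : ℝ} (hc : 1 ≤ c) (n : ℕ) : 0 ≤ chebU c n ∧ chebU c n + 1 ≤ chebU c (n + 1) := by
  induction n with
  | zero => simp [chebU]
  | succ n ih =>
    refine ⟨by linarith, ?_⟩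
    rw [chebU]
    nlinarith

/-- alternating product of length `n`, with rightmost factor `y`. -/
def altE {M : Type*} [Monoid M] (x y : M) : ℕ → M
  | 0 => 1
  | n + 1 => (if Even n then y else x) * altE x y n

theorem altE_succ' {M : Type*} [Monoid M] (x y : M) (n : ℕ) :
    altE x y (n + 1) = altE y x n * y := by
  induction n with
  | zero => simp [altE]
  | succ n ih =>
    rw [altE, ih, altE, mul_assoc]
    congr 1
    by_cases h : Even n <;> simp [h, Nat.even_add_one]

/-- `w` is a product of a word of length `n`. -/
def Wd {S M : Type*} [Monoid M] (ρ : S → M) (n : ℕ) (w : M) : Prop :=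
  ∃ L : List S, L.length = n ∧ (L.map ρ).prod = w

section Words
variable {S M : Type*} [Monoid M] {ρ : S → M}

theorem Wd_one : Wd ρ 0 1 := ⟨[], rfl, rfl⟩

theorem Wd_gen (s : S) : Wd ρ 1 (ρ s) := ⟨[s], rfl, by simp⟩

theorem Wd_mul {m n : ℕ} {v w : M} (hv : Wd ρ m v) (hw : Wd ρ n w) : Wd ρ (m + n) (v * w) := by
  obtain ⟨L, rfl, rfl⟩ := hv
  obtain ⟨K, rfl, rfl⟩ := hw
  exact ⟨L ++ K, by simp, by simp⟩

theorem Wd_zero {w : M} (h : Wd ρ 0 w) : w = 1 := by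
  obtain ⟨L, h, rfl⟩ := h
  rw [List.length_eq_zero_iff.1 h]; rfl

theorem Wd_succ {n : ℕ} {w : M} (h : Wd ρ (n + 1) w) : ∃ v t, Wd ρ n v ∧ w = v * ρ t := by
  obtain ⟨L, h, rfl⟩ := h
  rcases List.eq_nil_or_concat L with rfl | ⟨K, t, rfl⟩
  · simp at h
  · refine ⟨_, t, ⟨K, by simpa using h, rfl⟩, by simp⟩

theorem Wd_altE (s t : S) (n : ℕ) : Wd ρ n (altE (ρ s) (ρ t) n) := by
  induction n with
  | zero => exact Wd_one
  | succ n ih =>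
    rw [altE, add_comm]
    split_ifs
    · exact Wd_mul (Wd_gen _) ih
    · exact Wd_mul (Wd_gen _) ih

theorem altE_factor (s t : S) (m k : ℕ) :
    ∃ F, Wd ρ k F ∧ altE (ρ s) (ρ t) (k + m) = F * altE (ρ s) (ρ t) m := by
  induction k with
  | zero => exact ⟨1, Wd_one, by simp⟩
  | succ k ih =>
    obtain ⟨F, hF, e⟩ := ih
    rw [add_right_comm, altE, e, ← mul_assoc]
    refine ⟨_, ?_, rfl⟩
    rw [add_comm]
    split_ifs
    · exact Wd_mul (Wd_gen _) hF
    · exact Wd_mul (Wd_gen _) hF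

theorem Wd_closure {w : M} : w ∈ Submonoid.closure (Set.range ρ) ↔ ∃ n, Wd ρ n w := by
  constructor
  · intro h
    induction h using Submonoid.closure_induction with
    | mem x hx => obtain ⟨s, rfl⟩ := hx; exact ⟨1, Wd_gen s⟩
    | one => exact ⟨0, Wd_one⟩
    | mul x y _ _ hx hy =>
      obtain ⟨m, hm⟩ := hx
      obtain ⟨n, hn⟩ := hy
      exact ⟨_, Wd_mul hm hn⟩
  · rintro ⟨n, L, -, rfl⟩
    apply Submonoid.list_prod_mem
    intro x hx
    obtain ⟨s, -, rfl⟩ := List.mem_map.1 hx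
    exact Submonoid.subset_closure ⟨s, rfl⟩

/-- The combinatorial part: decomposition of a reduced word. -/
theorem Wd_decomp (hinv : ∀ s, ρ s * ρ s = 1) {n : ℕ} {w : M} (hw : Wd ρ (n + 1) w)
    (hred : ∀ j, Wd ρ j w → n + 1 ≤ j) (s : S) (hs : ∀ j, Wd ρ j (w * ρ s) → n + 1 ≤ j) :
    ∃ t, t ≠ s ∧ ∃ i k v, i + k = n + 1 ∧ 1 ≤ k ∧ Wd ρ i v ∧ w = v * altE (ρ s) (ρ t) k ∧
      (∀ j, Wd ρ j v → i ≤ j) ∧ (∀ j, Wd ρ j (v * ρ s) → i ≤ j) ∧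
      (∀ j, Wd ρ j (v * ρ t) → i ≤ j) ∧
      (∀ m, 1 ≤ m → altE (ρ s) (ρ t) m = altE (ρ t) (ρ s) m → k < m) := by
  classical
  obtain ⟨u, t, hu, rfl⟩ := Wd_succ hw
  have hts : t ≠ s := by
    rintro rfl
    rw [mul_assoc, hinv, mul_one] at hs
    have := hs n hu
    omega
  refine ⟨t, hts, ?_⟩
  let P : ℕ → Prop := fun k => ∃ i v, i + k = n + 1 ∧ Wd ρ i v ∧ u * ρ t = v * altE (ρ s) (ρ t) k
  have hP1 : P 1 := ⟨n, u, rfl, hu, by simp [altE]⟩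
  set k := Nat.findGreatest P (n + 1) with hk
  have hPk : P k := Nat.findGreatest_spec (by omega : 1 ≤ n + 1) hP1
  have hk1 : 1 ≤ k := Nat.le_findGreatest (by omega) hP1
  have hmax : ¬ P (k + 1) := by
    intro h
    by_cases hle : k + 1 ≤ n + 1
    · have := Nat.le_findGreatest hle h
      omega
    · obtain ⟨i, v, h1, -⟩ := h
      omega
  obtain ⟨i, v, hik, hv, he⟩ := hPk
  have hvred : ∀ j, Wd ρ j v → i ≤ j := by
    intro j hj
    have := hred _ (he ▸ Wd_mul hj (Wd_altE s t k))
    omega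
  -- the letter `if Even k then t else s` cannot shorten
  have key : ∀ x, (x = s ∨ x = t) → ∀ j, Wd ρ j (v * ρ x) → i ≤ j := by
    intro x hx j hj
    by_contra hlt
    push Not at hlt
    have hv' : v = v * ρ x * ρ x := by rw [mul_assoc, hinv, mul_one]
    have hji : j + 1 = i := by
      have := hvred (j + 1) (by rw [hv']; exact Wd_mul hj (Wd_gen x))
      omega
    obtain ⟨l, hl⟩ : ∃ l, k = l + 1 := ⟨k - 1, by omega⟩
    by_cases hxk : x = if Even k then t else s
    · apply hmax
      refine ⟨j, v * ρ x, by omega, hj, ?_⟩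
      rw [altE]
      have : (if Even k then ρ t else ρ s) = ρ x := by rw [hxk]; split_ifs <;> rfl
      rw [this, ← mul_assoc, ← hv', he]
    · have hxl : x = if Even l then t else s := by
        rw [hl] at hxk
        by_cases hev : Even l
        · simp [hev, Nat.even_add_one] at hxk ⊢
          tauto
        · simp [hev, Nat.even_add_one] at hxk ⊢
          tauto
      have : (if Even l then ρ t else ρ s) = ρ x := by rw [hxl]; split_ifs <;> rfl
      have h2 : u * ρ t = (v * ρ x) * altE (ρ s) (ρ t) l := by
        rw [he, hl, altE, this, ← mul_assoc]
      have := hred _ (h2 ▸ Wd_mul hj (Wd_altE s t l))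
      omega
  refine ⟨i, k, v, hik, hk1, hv, he, hvred, key s (Or.inl rfl), key t (Or.inr rfl), ?_⟩
  intro m hm hbr
  by_contra hkm
  push Not at hkm
  obtain ⟨F, hF, e⟩ := altE_factor (ρ := ρ) s t m (k - m)
  rw [Nat.sub_add_cancel hkm, hbr] at e
  obtain ⟨l, rfl⟩ : ∃ l, m = l + 1 := ⟨m - 1, by omega⟩
  rw [altE_succ'] at e
  have h2 : u * ρ t * ρ s = v * (F * altE (ρ s) (ρ t) l) := by
    rw [he, e]
    simp only [mul_assoc, hinv, mul_one]
  have := hs _ (h2 ▸ Wd_mul hv (Wd_mul hF (Wd_altE s t l)))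
  omega

end Words

theorem altE_apply {V₂ : Type*} [AddCommGroup V₂] [Module ℝ V₂]
    (pair : V →ₗ[ℝ] V₂ →ₗ[ℝ] ℝ) {as at' : V} {bs bt : V₂} {c κ : ℝ} (hκ : 0 < κ)
    (h1 : pair as bs = 1) (h2 : pair at' bt = 1) (h3 : pair as bt = - (c * κ))
    (h4 : pair at' bs = - (c / κ)) {ρs ρt : Module.End ℝ V}
    (hs : ∀ x, ρs x = x - (2 * pair x bs) • as) (ht : ∀ x, ρt x = x - (2 * pair x bt) • at')
    (n : ℕ) :
    altE ρs ρt n as = (if Even n then chebU c (n + 1) else chebU c n) • as +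
      (κ * (if Even n then chebU c n else chebU c (n + 1))) • at' := by
  induction n with
  | zero => simp [altE, chebU]
  | succ n ih =>
    rw [altE, Module.End.mul_apply, ih]
    by_cases hn : Even n
    · simp only [hn, if_true, Nat.even_add_one, not_true, if_false, ht, map_add, map_smul,
        LinearMap.add_apply, LinearMap.smul_apply, h2, h3, smul_eq_mul]
      rw [chebU]
      module
    · simp only [hn, if_true, Nat.even_add_one, not_false_eq_true, if_false, hs, map_add, map_smul,
        LinearMap.add_apply, LinearMap.smul_apply, h1, h4, smul_eq_mul]
      rw [chebU]
      match_scalars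
      · field_simp
        ring
      · ring

theorem altE_fix {x : V} {ρs ρt : Module.End ℝ V} (hs : ρs x = x) (ht : ρt x = x) (n : ℕ) :
    altE ρs ρt n x = x := by
  induction n with
  | zero => rfl
  | succ n ih =>
    rw [altE, Module.End.mul_apply, ih]
    split_ifs <;> assumption

theorem braid_aux {V₂ : Type*} [AddCommGroup V₂] [Module ℝ V₂]
    (pair : V →ₗ[ℝ] V₂ →ₗ[ℝ] ℝ) {as at' : V} {bs bt : V₂} {c κ : ℝ} (hκ : 0 < κ)
    (h1 : pair as bs = 1) (h2 : pair at' bt = 1) (h3 : pair as bt = - (c * κ))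
    (h4 : pair at' bs = - (c / κ)) {ρs ρt : Module.End ℝ V}
    (hs : ∀ x, ρs x = x - (2 * pair x bs) • as) (ht : ∀ x, ρt x = x - (2 * pair x bt) • at')
    (m : ℕ) (hm : chebU c (m + 1) = 0) :
    altE ρs ρt (m + 1) as = altE ρt ρs (m + 1) as := by
  have e : ρs as = - as := by
    rw [hs, h1]; module
  rw [altE_succ' ρt ρs, Module.End.mul_apply, e, map_neg,
    altE_apply pair hκ h1 h2 h3 h4 hs ht, altE_apply pair hκ h1 h2 h3 h4 hs ht, chebU, hm]
  by_cases h : Even m <;> simp [h, Nat.even_add_one]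

theorem braid {V₂ : Type*} [AddCommGroup V₂] [Module ℝ V₂]
    (pair : V →ₗ[ℝ] V₂ →ₗ[ℝ] ℝ) {as at' : V} {bs bt : V₂} {c κ : ℝ} (hκ : 0 < κ)
    (h1 : pair as bs = 1) (h2 : pair at' bt = 1) (h3 : pair as bt = - (c * κ))
    (h4 : pair at' bs = - (c / κ)) {ρs ρt : Module.End ℝ V}
    (hs : ∀ x, ρs x = x - (2 * pair x bs) • as) (ht : ∀ x, ρt x = x - (2 * pair x bt) • at')
    (m : ℕ) (hm : chebU c (m + 1) = 0) (hc : 1 - c ^ 2 ≠ 0) :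
    altE ρs ρt (m + 1) = altE ρt ρs (m + 1) := by
  have b1 := braid_aux pair hκ h1 h2 h3 h4 hs ht m hm
  have b2 := braid_aux pair (inv_pos.2 hκ) h2 h1 (by rw [h4]; rfl) (by rw [h3, div_inv_eq_mul])
    ht hs m hm
  ext x
  let p : ℝ := (pair x bs + c / κ * pair x bt) / (1 - c ^ 2)
  let q : ℝ := (pair x bt + c * κ * pair x bs) / (1 - c ^ 2)
  let y : V := x - p • as - q • at'
  have y1 : pair y bs = 0 := by
    simp only [y, p, q, map_sub, map_smul, LinearMap.sub_apply, LinearMap.smul_apply, h1, h4,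
      smul_eq_mul]
    field_simp
    ring
  have y2 : pair y bt = 0 := by
    simp only [y, p, q, map_sub, map_smul, LinearMap.sub_apply, LinearMap.smul_apply, h2, h3,
      smul_eq_mul]
    field_simp
    ring
  have f1 : ρs y = y := by rw [hs, y1]; simp
  have f2 : ρt y = y := by rw [ht, y2]; simp
  have hx : x = y + p • as + q • at' := by simp only [y]; abel
  rw [hx]
  simp only [map_add, map_smul, altE_fix f1 f2, altE_fix f2 f1, b1, b2]

theorem scaling {a b : ℝ} (ha : a ≤ 0) (hb : b ≤ 0) (h : a = 0 ↔ b = 0) :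
    ∃ c κ : ℝ, 0 ≤ c ∧ 0 < κ ∧ a = -(c * κ) ∧ b = -(c / κ) ∧ a * b = c ^ 2 := by
  by_cases h0 : a = 0
  · have := h.1 h0
    subst h0 this
    exact ⟨0, 1, by simp⟩
  · have hb0 : b ≠ 0 := fun hz => h0 (h.2 hz)
    have ha' : a < 0 := lt_of_le_of_ne ha h0
    have hb' : b < 0 := lt_of_le_of_ne hb hb0
    have hab : 0 < a * b := mul_pos_of_neg_of_neg ha' hb'
    have hr : 0 < √(a * b) := Real.sqrt_pos.2 hab
    have hsq : √(a * b) ^ 2 = a * b := Real.sq_sqrt hab.le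
    refine ⟨√(a * b), √(a * b) / (-b), hr.le, div_pos hr (by linarith), ?_, ?_, hsq.symm⟩
    · field_simp
      rw [hsq]
    · rw [div_div_cancel₀ hr.ne', neg_neg]

theorem chebU_pos {m k : ℕ} (hk : 1 ≤ k) (hkm : k < m) :
    0 < chebU (Real.cos (Real.pi / m)) k := by
  have hm0 : (0 : ℝ) < m := by exact_mod_cast (by omega : 0 < m)
  have hm1 : (1 : ℝ) < m := by exact_mod_cast (by omega : 1 < m)
  have hsin : 0 < Real.sin (Real.pi / m) := by
    apply Real.sin_pos_of_pos_of_lt_pi (div_pos Real.pi_pos hm0)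
    exact div_lt_self Real.pi_pos hm1
  have h := chebU_cos (Real.pi / m) k
  have : 0 < Real.sin (k * (Real.pi / m)) := by
    have hk' : (0 : ℝ) < k := by exact_mod_cast hk
    have hkm' : (k : ℝ) < m := by exact_mod_cast hkm
    apply Real.sin_pos_of_pos_of_lt_pi (mul_pos hk' (div_pos Real.pi_pos hm0))
    rw [← mul_div_assoc, div_lt_iff₀ hm0]
    nlinarith [Real.pi_pos]
  rw [← h] at this
  exact pos_of_mul_pos_left this hsin.le

theorem chebU_zero {m : ℕ} (hm : 2 ≤ m) :
    chebU (Real.cos (Real.pi / m)) m = 0 ∧ 1 - Real.cos (Real.pi / m) ^ 2 ≠ 0 := by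
  have hm0 : (0 : ℝ) < m := by exact_mod_cast (by omega : 0 < m)
  have hm1 : (1 : ℝ) < m := by exact_mod_cast (by omega : 1 < m)
  have hsin : 0 < Real.sin (Real.pi / m) := by
    apply Real.sin_pos_of_pos_of_lt_pi (div_pos Real.pi_pos hm0)
    exact div_lt_self Real.pi_pos hm1
  have h := chebU_cos (Real.pi / m) m
  constructor
  · rw [mul_div_cancel₀ _ hm0.ne', Real.sin_pi] at h
    exact (mul_eq_zero.1 h).resolve_right hsin.ne'
  · have := Real.sin_sq_add_cos_sq (Real.pi / m)
    have h2 : 0 < Real.sin (Real.pi / m) ^ 2 := by positivity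
    linarith

theorem cheb_mixed {c : ℝ} (h0 : 0 ≤ c) (h1 : c < 1) :
    (∃ m : ℕ, 2 ≤ m ∧ c ^ 2 = Real.cos (Real.pi / m) ^ 2) ∨
      ∃ m : ℕ, 0 < chebU c m ∧ chebU c (m + 1) < 0 := by
  set θ := Real.arccos c with hθ
  have hcos : Real.cos θ = c := Real.cos_arccos (by linarith) h1.le
  have hθ0 : 0 < θ := Real.arccos_pos.2 h1
  have hθ1 : θ ≤ Real.pi / 2 := Real.arccos_le_pi_div_two.2 h0
  have hpi := Real.pi_pos
  have hsin : 0 < Real.sin θ := Real.sin_pos_of_pos_of_lt_pi hθ0 (by linarith)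
  set m := ⌊Real.pi / θ⌋₊ with hm
  have hm2 : 2 ≤ m := by
    apply Nat.le_floor
    rw [le_div_iff₀ hθ0]
    push_cast
    linarith
  have hle : m * θ ≤ Real.pi := by
    rw [← le_div_iff₀ hθ0]
    exact Nat.floor_le (by positivity)
  have hlt : Real.pi < (m + 1) * θ := by
    rw [← div_lt_iff₀ hθ0]
    exact Nat.lt_floor_add_one _
  have hmpos : (0 : ℝ) < m := by exact_mod_cast (by omega : 0 < m)
  rcases hle.eq_or_lt with heq | hlt'
  · left
    refine ⟨m, hm2, ?_⟩
    rw [← heq, mul_div_cancel_left₀ _ hmpos.ne', hcos]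
  · right
    refine ⟨m, ?_, ?_⟩
    · have h := chebU_cos θ m
      have h2 : 0 < Real.sin (m * θ) := Real.sin_pos_of_pos_of_lt_pi (by positivity) hlt'
      rw [← h, hcos] at h2
      exact pos_of_mul_pos_left h2 hsin.le
    · have h := chebU_cos θ (m + 1)
      have h2 : Real.sin ((m + 1 : ℕ) * θ) < 0 := by
        rw [← Real.sin_sub_two_pi]
        apply Real.sin_neg_of_neg_of_neg_pi_lt
        · push_cast
          linarith
        · push_cast
          linarith
      rw [← h, hcos] at h2
      by_contra hn
      push Not at hn
      have := mul_nonneg hn hsin.le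
      linarith

theorem rho_self {S V₂ : Type*} [AddCommGroup V₂] [Module ℝ V₂]
    (pair : V →ₗ[ℝ] V₂ →ₗ[ℝ] ℝ) (α : S → V) (β : S → V₂)
    (D1 : ∀ s, pair (α s) (β s) = 1) (ρ : S → Module.End ℝ V)
    (hρ : ∀ s x, ρ s x = x - (2 * pair x (β s)) • α s) (s : S) : ρ s * ρ s = 1 := by
  ext x
  rw [Module.End.mul_apply, hρ, hρ]
  simp only [map_sub, map_smul, LinearMap.sub_apply, LinearMap.smul_apply, D1, smul_eq_mul,
    Module.End.one_apply]
  module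

theorem main_pos {S V₂ : Type*} [AddCommGroup V₂] [Module ℝ V₂]
    (pair : V →ₗ[ℝ] V₂ →ₗ[ℝ] ℝ) (α : S → V) (β : S → V₂)
    (D1 : ∀ s, pair (α s) (β s) = 1) (ρ : S → Module.End ℝ V)
    (hρ : ∀ s x, ρ s x = x - (2 * pair x (β s)) • α s)
    (H : ∀ s t : S,
        (s ≠ t → pair (α s) (β t) ≤ 0 ∧ pair (α t) (β s) ≤ 0) ∧
        (pair (α s) (β t) = 0 ↔ pair (α t) (β s) = 0) ∧
        ((∃ m : ℕ, 2 ≤ m ∧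
            pair (α s) (β t) * pair (α t) (β s) = Real.cos (Real.pi / m) ^ 2) ∨
          1 ≤ pair (α s) (β t) * pair (α t) (β s)))
    (n : ℕ) : ∀ (w : Module.End ℝ V) (s : S), Wd ρ n w → (∀ j, Wd ρ j w → n ≤ j) →
      (∀ j, Wd ρ j (w * ρ s) → n ≤ j) → w (α s) ∈ PLC (Set.range α) := by
  induction n using Nat.strong_induction_on with
  | _ n ih =>
  intro w s hw hred hs
  rcases n with _ | n
  · rw [Wd_zero hw]
    exact PLC_mem ⟨s, rfl⟩
  obtain ⟨t, hts, i, k, v, hik, hk, hv, rfl, hv1, hv2, hv3, hbr⟩ :=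
    Wd_decomp (rho_self pair α β D1 ρ hρ) hw hred s hs
  have p1 := ih i (by omega) v s hv hv1 hv2
  have p2 := ih i (by omega) v t hv hv1 hv3
  obtain ⟨H3, H4, H5⟩ := H s t
  obtain ⟨c, κ, hc, hκ, ha, hb, hab⟩ := scaling (H3 hts.symm).1 (H3 hts.symm).2 H4
  have hU : 0 < chebU c k ∧ 0 ≤ chebU c (k + 1) := by
    rw [hab] at H5
    rcases H5 with ⟨m, hm, e⟩ | h
    · have hcos : 0 ≤ Real.cos (Real.pi / m) := by
        have hm0 : (2 : ℝ) ≤ m := by exact_mod_cast hm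
        have hpi := Real.pi_pos
        apply Real.cos_nonneg_of_neg_pi_div_two_le_of_le
        · have : 0 ≤ Real.pi / m := by positivity
          linarith
        · exact div_le_div_of_nonneg_left hpi.le two_pos hm0
      have hce : c = Real.cos (Real.pi / m) := (sq_eq_sq₀ hc hcos).1 e
      obtain ⟨z1, z2⟩ := chebU_zero hm
      rw [← hce] at z1 z2
      have hkm : k < m := by
        apply hbr m (by omega)
        obtain ⟨l, rfl⟩ : ∃ l, m = l + 1 := ⟨m - 1, by omega⟩
        exact braid pair hκ (D1 s) (D1 t) ha hb (hρ s) (hρ t) l z1 z2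
      refine ⟨hce ▸ chebU_pos hk hkm, ?_⟩
      rcases Nat.lt_or_ge (k + 1) m with h | h
      · exact hce ▸ (chebU_pos (by omega) h).le
      · have : k + 1 = m := by omega
        rw [this, z1]
    · have hc1 : 1 ≤ c := by nlinarith
      obtain ⟨l, rfl⟩ : ∃ l, k = l + 1 := ⟨k - 1, by omega⟩
      have g1 := chebU_ge hc1 l
      have g2 := chebU_ge hc1 (l + 1)
      exact ⟨by linarith, by linarith⟩
  rw [Module.End.mul_apply, altE_apply pair hκ (D1 s) (D1 t) ha hb (hρ s) (hρ t), map_add,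
    map_smul, map_smul]
  obtain ⟨u1, u2⟩ := hU
  by_cases hev : Even k
  · simp only [hev, if_true]
    exact PLC_comb p1 p2 u2 (by positivity) (Or.inr (by positivity))
  · simp only [hev, if_false]
    exact PLC_comb p1 p2 u1.le (by positivity) (Or.inl u1)

end helpers

/-- Under (D1) and (D2), `Φ₁ = Φ₁⁺ ⊎ Φ₁⁻` holds if and only if for all
`s, t ∈ S` conditions (D3), (D4), (D5) hold:
(D3) `⟨αₛ, βₜ⟩ ≤ 0` and `⟨αₜ, βₛ⟩ ≤ 0` whenever `s ≠ t`;
(D4) `⟨αₛ, βₜ⟩ = 0` iff `⟨αₜ, βₛ⟩ = 0`;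
(D5) either `⟨αₛ, βₜ⟩⟨αₜ, βₛ⟩ = cos²(π/m)` for some integer `m ≥ 2`, or
`⟨αₛ, βₜ⟩⟨αₜ, βₛ⟩ ≥ 1`. -/
theorem stmt1 {S V₁ V₂ : Type*} [AddCommGroup V₁] [Module ℝ V₁]
    [AddCommGroup V₂] [Module ℝ V₂]
    (pair : V₁ →ₗ[ℝ] V₂ →ₗ[ℝ] ℝ) (α : S → V₁) (β : S → V₂)
    (hα : Function.Injective α) (hβ : Function.Injective β)
    (D1 : ∀ s, pair (α s) (β s) = 1)
    (D2a : (0 : V₁) ∉ PLC (Set.range α)) (D2b : (0 : V₂) ∉ PLC (Set.range β))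
    (D2c : ∀ s, α s ∉ PLC (Set.range α \ {α s}))
    (D2d : ∀ s, β s ∉ PLC (Set.range β \ {β s}))
    (ρ₁ : S → Module.End ℝ V₁)
    (hρ₁ : ∀ s x, ρ₁ s x = x - (2 * pair x (β s)) • α s)
    (Φ₁ : Set V₁)
    (hΦ₁ : Φ₁ = { v | ∃ w ∈ Submonoid.closure (Set.range ρ₁), ∃ s, v = w (α s) }) :
    (Φ₁ = (Φ₁ ∩ PLC (Set.range α)) ∪ (-(Φ₁ ∩ PLC (Set.range α))) ∧
        Disjoint (Φ₁ ∩ PLC (Set.range α)) (-(Φ₁ ∩ PLC (Set.range α)))) ↔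
      (∀ s t : S,
        (s ≠ t → pair (α s) (β t) ≤ 0 ∧ pair (α t) (β s) ≤ 0) ∧
        (pair (α s) (β t) = 0 ↔ pair (α t) (β s) = 0) ∧
        ((∃ m : ℕ, 2 ≤ m ∧
            pair (α s) (β t) * pair (α t) (β s) = Real.cos (Real.pi / m) ^ 2) ∨
          1 ≤ pair (α s) (β t) * pair (α t) (β s))) := by
  classical
  have hinv := rho_self pair α β D1 ρ₁ hρ₁
  have hself : ∀ s, ρ₁ s (α s) = - α s := by
    intro s
    rw [hρ₁, D1]
    module
  have hmem : ∀ v, v ∈ Φ₁ ↔ ∃ n w s, Wd ρ₁ n w ∧ v = w (α s) := by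
    intro v
    rw [hΦ₁]
    constructor
    · rintro ⟨w, hw, s, rfl⟩
      obtain ⟨n, hn⟩ := Wd_closure.1 hw
      exact ⟨n, w, s, hn, rfl⟩
    · rintro ⟨n, w, s, hn, rfl⟩
      exact ⟨w, Wd_closure.2 ⟨n, hn⟩, s, rfl⟩
  constructor
  · rintro ⟨heq, -⟩
    have hdec : ∀ v ∈ Φ₁, v ∈ PLC (Set.range α) ∨ -v ∈ PLC (Set.range α) := by
      intro v hv
      rw [heq] at hv
      rcases hv with h | h
      · exact Or.inl h.2
      · exact Or.inr (Set.mem_neg.1 h).2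
    have hmix : ∀ s t, s ≠ t → ∀ p q : ℝ, 0 < p → 0 < q → p • α s - q • α t ∉ Φ₁ := by
      intro s t hst p q hp hq hv
      rcases hdec _ hv with h | h
      · exact PLC_mixed (Set.mem_range_self s) (Set.mem_range_self t) (fun e => hst (hα e).symm) D2a (D2c s) hq h
      · rw [neg_sub] at h
        exact PLC_mixed (Set.mem_range_self t) (Set.mem_range_self s) (fun e => hst (hα e)) D2a (D2c t) hp h
    have hD3 : ∀ s t, s ≠ t → pair (α s) (β t) ≤ 0 := by
      intro s t hst
      by_contra hn
      push Not at hn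
      apply hmix s t hst 1 (2 * pair (α s) (β t)) one_pos (by linarith)
      rw [hmem]
      exact ⟨1, ρ₁ t, s, Wd_gen t, by rw [hρ₁, one_smul]⟩
    have hD4 : ∀ s t, s ≠ t → pair (α s) (β t) = 0 → pair (α t) (β s) = 0 := by
      intro s t hst h0
      by_contra hn
      have hb : pair (α t) (β s) < 0 := lt_of_le_of_ne (hD3 t s hst.symm) hn
      apply hmix s t hst (-(2 * pair (α t) (β s))) 1 (by linarith) one_pos
      rw [hmem]
      refine ⟨2, ρ₁ t * ρ₁ s, t, Wd_mul (Wd_gen t) (Wd_gen s), ?_⟩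
      rw [Module.End.mul_apply, hρ₁ s, map_sub, map_smul, hself, hρ₁ t, h0]
      module
    intro s t
    by_cases hst : s = t
    · subst hst
      refine ⟨fun h => absurd rfl h, Iff.rfl, Or.inr ?_⟩
      rw [D1]
      norm_num
    have h4 : pair (α s) (β t) = 0 ↔ pair (α t) (β s) = 0 :=
      ⟨hD4 s t hst, hD4 t s (Ne.symm hst)⟩
    have h3 := hD3 s t hst
    have h3' := hD3 t s (Ne.symm hst)
    refine ⟨fun _ => ⟨h3, h3'⟩, h4, ?_⟩
    obtain ⟨c, κ, hc, hκ, ha, hb, hab⟩ := scaling h3 h3' h4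
    rw [hab]
    rcases lt_or_ge c 1 with hc1 | hc1
    · rcases cheb_mixed hc hc1 with h | ⟨m, u1, u2⟩
      · exact Or.inl h
      · exfalso
        have hin : altE (ρ₁ s) (ρ₁ t) m (α s) ∈ Φ₁ := by
          rw [hmem]
          exact ⟨m, _, s, Wd_altE s t m, rfl⟩
        rw [altE_apply pair hκ (D1 s) (D1 t) ha hb (hρ₁ s) (hρ₁ t)] at hin
        by_cases hev : Even m
        · simp only [hev, if_true] at hin
          apply hmix t s (Ne.symm hst) (κ * chebU c m) (-chebU c (m + 1)) (by positivity)
            (by linarith)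
          convert hin using 1
          module
        · simp only [hev, if_false] at hin
          apply hmix s t hst (chebU c m) (κ * (-chebU c (m + 1))) u1
            (mul_pos hκ (by linarith))
          convert hin using 1
          module
    · right
      nlinarith
  · intro H
    have hneg : ∀ v ∈ Φ₁, -v ∈ Φ₁ := by
      intro v hv
      rw [hmem] at hv ⊢
      obtain ⟨n, w, s, hw, rfl⟩ := hv
      refine ⟨n + 1, w * ρ₁ s, s, Wd_mul hw (Wd_gen s), ?_⟩
      rw [Module.End.mul_apply, hself, map_neg]
    have hmain := main_pos pair α β D1 ρ₁ hρ₁ H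
    have hdec : ∀ v ∈ Φ₁, v ∈ PLC (Set.range α) ∨ -v ∈ PLC (Set.range α) := by
      intro v hv
      obtain ⟨n₀, w, s, hw, rfl⟩ := (hmem v).1 hv
      have ex1 : ∃ n, Wd ρ₁ n w := ⟨n₀, hw⟩
      have ex2 : ∃ n, Wd ρ₁ n (w * ρ₁ s) := ⟨_, Wd_mul hw (Wd_gen s)⟩
      rcases le_total (Nat.find ex1) (Nat.find ex2) with h | h
      · left
        exact hmain _ w s (Nat.find_spec ex1) (fun j hj => Nat.find_min' ex1 hj)
          (fun j hj => h.trans (Nat.find_min' ex2 hj))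
      · right
        have := hmain _ (w * ρ₁ s) s (Nat.find_spec ex2) (fun j hj => Nat.find_min' ex2 hj)
          (fun j hj => h.trans (Nat.find_min' ex1 (by rwa [mul_assoc, hinv, mul_one] at hj)))
        rwa [Module.End.mul_apply, hself, map_neg] at this
    constructor
    · ext v
      constructor
      · intro hv
        rcases hdec v hv with h | h
        · exact Or.inl ⟨hv, h⟩
        · exact Or.inr (Set.mem_neg.2 ⟨hneg v hv, h⟩)
      · rintro (h | h)
        · exact h.1
        · have := hneg _ (Set.mem_neg.1 h).1
          rwa [neg_neg] at this
    · rw [Set.disjoint_left]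
      intro v h1 h2
      have := PLC_add h1.2 (Set.mem_neg.1 h2).2
      rw [add_neg_cancel] at this
      exact D2a this
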